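/- Let λ < 0, and for n ≥ 2 let b_n be the unique real number with F_λ(b_n) = 1 - 1/n. Define h_n(x) = n log F_λ(b_n + x/((1+λ²) b_n)) + e^{-x}. Then for every real x, b_n² h_n(x) → κ(x) := 2^{-1}(1+λ²)^{-1}(x² + 4x) e^{-x} as n → ∞. -/

import Mathlib

open Real MeasureTheory Filter Topology

/-- Standard normal density. -/
noncomputable def stdPhi (x : ℝ) : ℝ := (Real.sqrt (2 * Real.pi))⁻¹ * Real.exp (-(x ^ 2) / 2)

/-- Standard normal cdf. -/
noncomputable def stdCdf (x : ℝ) : ℝ := ∫ t in Set.Iic x, stdPhi t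

/-- Skew normal density with shape parameter l. -/
noncomputable def snPdf (l x : ℝ) : ℝ := 2 * stdPhi x * stdCdf (l * x)

/-- Skew normal cdf with shape parameter l. -/
noncomputable def snCdf (l x : ℝ) : ℝ := ∫ t in Set.Iic x, snPdf l t

/-- Gumbel extreme value distribution function. -/
noncomputable def gumbel (x : ℝ) : ℝ := Real.exp (-Real.exp (-x))

/-- $\kappa(x)$ for $\lambda<0$. -/
noncomputable def kappaNeg (l x : ℝ) : ℝ :=
  2⁻¹ * (1 + l ^ 2)⁻¹ * (x ^ 2 + 4 * x) * Real.exp (-x)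

open ProbabilityTheory

/-- First-order Mills ratio. -/
lemma mills_one (f G q : ℝ → ℝ) (c m : ℝ) (hc : 0 < c)
    (hfpos : ∀ t, 0 < f t)
    (hf : ∀ t, HasDerivAt f (-(q t * f t)) t)
    (hG : ∀ t, HasDerivAt G (-(f t)) t)
    (hf0 : Tendsto f atTop (𝓝 0)) (hG0 : Tendsto G atTop (𝓝 0))
    (hq : Tendsto (fun t => t * (q t - c * t)) atTop (𝓝 m)) :
    Tendsto (fun t => G t / (f t / t)) atTop (𝓝 c⁻¹) := by
  have hinv : Tendsto (fun t : ℝ => t⁻¹) atTop (𝓝 0) := tendsto_inv_atTop_zero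
  have hlim : Tendsto (fun t => t * (q t - c * t) * (t⁻¹ * t⁻¹) + c + t⁻¹ * t⁻¹) atTop (𝓝 c) := by
    have := ((hq.mul (hinv.mul hinv)).add_const c).add (hinv.mul hinv)
    simpa using this
  have hlim' := hlim.inv₀ hc.ne'
  refine HasDerivAt.lhopital_zero_atTop (f' := fun t => -(f t))
    (g' := fun t => (-(q t * f t) * t - f t * 1) / t ^ 2) (Eventually.of_forall hG) ?_ ?_ hG0 ?_ ?_
  · filter_upwards [eventually_gt_atTop 0] with t ht
    exact (hf t).div (hasDerivAt_id t) ht.ne'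
  · filter_upwards [eventually_gt_atTop 0, hlim.eventually (lt_mem_nhds hc)] with t ht h2
    have h3 : (-(q t * f t) * t - f t * 1) / t ^ 2 =
        -(f t) * (t * (q t - c * t) * (t⁻¹ * t⁻¹) + c + t⁻¹ * t⁻¹) := by
      field_simp; ring
    rw [h3]
    exact mul_ne_zero (neg_ne_zero.2 (hfpos t).ne') h2.ne'
  · simpa [div_eq_mul_inv] using hf0.mul hinv
  · refine hlim'.congr' ?_
    filter_upwards [eventually_gt_atTop 0, hlim.eventually (lt_mem_nhds hc)] with t ht h2
    have h3 : (-(q t * f t) * t - f t * 1) / t ^ 2 =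
        -(f t) * (t * (q t - c * t) * (t⁻¹ * t⁻¹) + c + t⁻¹ * t⁻¹) := by
      field_simp; ring
    rw [h3]
    have := (hfpos t).ne'
    rw [← div_div, div_self (neg_ne_zero.2 this), one_div]

/-- Second-order Mills ratio. -/
lemma mills_two (f G q : ℝ → ℝ) (c m : ℝ) (hc : 0 < c)
    (hfpos : ∀ t, 0 < f t)
    (hf : ∀ t, HasDerivAt f (-(q t * f t)) t)
    (hG : ∀ t, HasDerivAt G (-(f t)) t)
    (hf0 : Tendsto f atTop (𝓝 0)) (hG0 : Tendsto G atTop (𝓝 0))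
    (hq : Tendsto (fun t => t * (q t - c * t)) atTop (𝓝 m)) :
    (∀ᶠ t in atTop, 0 < G t) ∧
    Tendsto (fun t => t * (f t / G t - c * t)) atTop (𝓝 (m + 1)) := by
  have h1 := mills_one f G q c m hc hfpos hf hG hf0 hG0 hq
  have hinv : Tendsto (fun t : ℝ => t⁻¹) atTop (𝓝 0) := tendsto_inv_atTop_zero
  have hpos : ∀ᶠ t in atTop, 0 < G t := by
    filter_upwards [eventually_gt_atTop 0, h1.eventually (lt_mem_nhds (inv_pos.2 hc))] with t ht h2
    have h3 : 0 < f t / t := div_pos (hfpos t) ht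
    exact (div_pos_iff_of_pos_right h3).1 h2
  refine ⟨hpos, ?_⟩
  have hden : Tendsto (fun t => 1 + G t / (f t / t) * (t⁻¹ * t⁻¹)) atTop (𝓝 1) := by
    have := (h1.mul (hinv.mul hinv)).const_add 1
    simpa using this
  have hnum : Tendsto (fun t => t * (q t - c * t) + c * (G t / (f t / t))) atTop (𝓝 (m + 1)) := by
    have := hq.add (h1.const_mul c)
    rwa [mul_inv_cancel₀ hc.ne'] at this
  have hrat := hnum.div hden one_ne_zero
  rw [div_one] at hrat
  have key : Tendsto (fun t => (f t - c * (t * G t)) / (G t / t)) atTop (𝓝 (m + 1)) := by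
    refine HasDerivAt.lhopital_zero_atTop
      (f' := fun t => -(q t * f t) - c * (1 * G t + t * (-(f t))))
      (g' := fun t => (-(f t) * t - G t * 1) / t ^ 2) ?_ ?_ ?_ ?_ ?_ ?_
    · refine Eventually.of_forall fun t => ?_
      exact (hf t).sub (((hasDerivAt_id t).mul (hG t)).const_mul c)
    · filter_upwards [eventually_gt_atTop 0] with t ht
      exact (hG t).div (hasDerivAt_id t) ht.ne'
    · filter_upwards [eventually_gt_atTop 0, hpos] with t ht h2
      have := hfpos t
      refine (div_neg_of_neg_of_pos ?_ (by positivity)).ne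
      nlinarith [mul_pos this ht]
    · have h5 : Tendsto (fun t => t * G t) atTop (𝓝 0) := by
        have := h1.mul hf0
        rw [mul_zero] at this
        refine this.congr' ?_
        filter_upwards [eventually_gt_atTop 0] with t ht
        have := (hfpos t).ne'
        field_simp
      simpa using hf0.sub (h5.const_mul c)
    · simpa [div_eq_mul_inv] using hG0.mul hinv
    · refine hrat.congr' ?_
      filter_upwards [eventually_gt_atTop 0, hpos] with t ht h2
      have := hfpos t
      simp only [Pi.div_apply]
      have e1 : -(f t) * t - G t * 1 ≠ 0 := by nlinarith [mul_pos this ht]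
      have e2 : f t * t + G t ≠ 0 := by positivity
      rw [div_eq_div_iff (by positivity) (div_ne_zero e1 (by positivity))]
      field_simp
      ring
  refine key.congr' ?_
  filter_upwards [eventually_gt_atTop 0, hpos] with t ht h2
  field_simp

lemma cdf_hasDerivAt (f : ℝ → ℝ) (hf : Continuous f) (hi : Integrable f) (x : ℝ) :
    HasDerivAt (fun x => ∫ t in Set.Iic x, f t) (f x) x := by
  have h : (fun x => ∫ t in Set.Iic x, f t)
      = fun x => (∫ t in (0:ℝ)..x, f t) + ∫ t in Set.Iic 0, f t := by
    funext y
    rw [← intervalIntegral.integral_Iic_sub_Iic hi.integrableOn hi.integrableOn]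
    ring
  rw [h]
  exact (intervalIntegral.integral_hasDerivAt_right (hf.intervalIntegrable _ _)
    (hf.stronglyMeasurableAtFilter _ _) hf.continuousAt).add_const _

lemma cdf_tendsto (f : ℝ → ℝ) (hi : Integrable f) :
    Tendsto (fun x => ∫ t in Set.Iic x, f t) atTop (𝓝 (∫ t, f t)) :=
  (aecover_Iic tendsto_id).integral_tendsto_of_countably_generated hi

lemma stdPhi_eq : stdPhi = gaussianPDFReal 0 1 := by
  funext x; simp [stdPhi, gaussianPDFReal]

lemma stdPhi_pos (x : ℝ) : 0 < stdPhi x := by unfold stdPhi; positivity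

lemma stdPhi_int : Integrable stdPhi := by
  rw [stdPhi_eq]; exact integrable_gaussianPDFReal 0 1

lemma stdPhi_total : ∫ t, stdPhi t = 1 := by
  rw [stdPhi_eq]; exact integral_gaussianPDFReal_eq_one 0 one_ne_zero

lemma stdPhi_cont : Continuous stdPhi := by unfold stdPhi; fun_prop

lemma stdPhi_neg (x : ℝ) : stdPhi (-x) = stdPhi x := by simp [stdPhi]

lemma stdPhi_hasDerivAt (x : ℝ) : HasDerivAt stdPhi (-(x * stdPhi x)) x := by
  have h1 : HasDerivAt (fun x : ℝ => -(x ^ 2) / 2) (-x) x := by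
    have := ((hasDerivAt_pow 2 x).neg).div_const 2
    exact this.congr_deriv (by simp; ring)
  have := (h1.exp).const_mul ((Real.sqrt (2 * Real.pi))⁻¹)
  refine HasDerivAt.congr_deriv this ?_
  simp only [stdPhi]; ring

lemma stdCdf_hasDerivAt (x : ℝ) : HasDerivAt stdCdf (stdPhi x) x :=
  cdf_hasDerivAt _ stdPhi_cont stdPhi_int x

lemma stdCdf_cont : Continuous stdCdf :=
  continuous_iff_continuousAt.2 fun x => (stdCdf_hasDerivAt x).continuousAt

lemma stdCdf_neg (x : ℝ) : stdCdf (-x) = 1 - stdCdf x := by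
  have h := intervalIntegral.integral_Iic_add_Ioi (b := x) stdPhi_int.integrableOn
    stdPhi_int.integrableOn
  rw [stdPhi_total] at h
  have h2 := integral_comp_neg_Iic (-x) stdPhi
  simp only [stdPhi_neg, neg_neg] at h2
  unfold stdCdf
  linarith

lemma stdCdf_pos (x : ℝ) : 0 < stdCdf x := by
  unfold stdCdf
  rw [setIntegral_pos_iff_support_of_nonneg_ae (Eventually.of_forall fun t => (stdPhi_pos t).le)
    stdPhi_int.integrableOn]
  have : Function.support stdPhi = Set.univ := by
    ext t; simp [(stdPhi_pos t).ne']
  rw [this]; simp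

lemma stdCdf_le (x : ℝ) : stdCdf x ≤ 1 := by
  have := stdCdf_pos (-x); rw [stdCdf_neg] at this; linarith

lemma snPdf_pos (l x : ℝ) : 0 < snPdf l x := by
  have := stdPhi_pos x; have := stdCdf_pos (l * x); unfold snPdf; positivity

lemma snPdf_cont (l : ℝ) : Continuous (snPdf l) := by
  have := stdPhi_cont; have := stdCdf_cont; unfold snPdf; fun_prop

lemma snPdf_le (l x : ℝ) : snPdf l x ≤ 2 * stdPhi x := by
  have := stdPhi_pos x; have := stdCdf_le (l * x); unfold snPdf; nlinarith

lemma snPdf_int (l : ℝ) : Integrable (snPdf l) := by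
  refine (stdPhi_int.const_mul 2).mono' (snPdf_cont l).aestronglyMeasurable ?_
  refine Eventually.of_forall fun x => ?_
  rw [Real.norm_of_nonneg (snPdf_pos l x).le]; exact snPdf_le l x

lemma snPdf_total (l : ℝ) : ∫ t, snPdf l t = 1 := by
  have h1 := integral_neg_eq_self (snPdf l) volume
  have h2 : ∀ t, snPdf l (-t) = 2 * stdPhi t - snPdf l t := by
    intro t
    simp only [snPdf, stdPhi_neg, mul_neg, stdCdf_neg]; ring
  simp only [h2] at h1
  rw [integral_sub (stdPhi_int.const_mul 2) (snPdf_int l), integral_const_mul, stdPhi_total] at h1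
  linarith

lemma pow_mul_stdPhi (k : ℕ) : Tendsto (fun t : ℝ => t ^ k * stdPhi t) atTop (𝓝 0) := by
  have h := (Real.tendsto_pow_mul_exp_neg_atTop_nhds_zero k).const_mul ((Real.sqrt (2 * Real.pi))⁻¹)
  rw [mul_zero] at h
  refine squeeze_zero' ?_ ?_ h
  · filter_upwards [eventually_ge_atTop 0] with t ht
    have := stdPhi_pos t; positivity
  · filter_upwards [eventually_ge_atTop 2] with t ht
    have : Real.exp (-(t ^ 2) / 2) ≤ Real.exp (-t) := Real.exp_le_exp.2 (by nlinarith)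
    unfold stdPhi
    calc t ^ k * ((√(2 * Real.pi))⁻¹ * Real.exp (-(t ^ 2) / 2))
        = (√(2 * Real.pi))⁻¹ * (t ^ k * Real.exp (-(t ^ 2) / 2)) := by ring
      _ ≤ _ := by gcongr

lemma pow_mul_snPdf (l : ℝ) (k : ℕ) : Tendsto (fun t : ℝ => t ^ k * snPdf l t) atTop (𝓝 0) := by
  have h := (pow_mul_stdPhi k).const_mul 2
  rw [mul_zero] at h
  refine squeeze_zero' ?_ ?_ h
  · filter_upwards [eventually_ge_atTop 0] with t ht
    have := snPdf_pos l t; positivity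
  · filter_upwards [eventually_ge_atTop 0] with t ht
    have := snPdf_le l t
    calc t ^ k * snPdf l t ≤ t ^ k * (2 * stdPhi t) := by gcongr
      _ = _ := by ring

lemma stdCdf_mills : Tendsto (fun t => t * (stdPhi t / stdCdf (-t) - 1 * t)) atTop (𝓝 (0 + 1)) := by
  refine (mills_two stdPhi (fun t => stdCdf (-t)) (fun t => t) 1 0 one_pos stdPhi_pos
    stdPhi_hasDerivAt ?_ (by simpa using pow_mul_stdPhi 0) ?_ (by simp)).2
  · intro t
    have := (stdCdf_hasDerivAt (-t)).scomp t (hasDerivAt_neg t)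
    rw [stdPhi_neg] at this
    exact HasDerivAt.congr_deriv this (by simp)
  · simp only [stdCdf_neg]
    have := (cdf_tendsto _ stdPhi_int).const_sub 1
    rw [stdPhi_total, sub_self] at this
    exact this

lemma snPdf_hasDerivAt (l x : ℝ) : HasDerivAt (snPdf l)
    (-((x - l * (stdPhi (l * x) / stdCdf (l * x))) * snPdf l x)) x := by
  have h1 : HasDerivAt (fun x => stdCdf (l * x)) (stdPhi (l * x) * l) x := by
    have := (stdCdf_hasDerivAt (l * x)).comp x ((hasDerivAt_id x).const_mul l)
    exact HasDerivAt.congr_deriv this (by simp)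
  have := (((stdPhi_hasDerivAt x).const_mul 2).mul h1)
  refine HasDerivAt.congr_deriv this ?_
  have := (stdCdf_pos (l * x)).ne'
  simp only [snPdf]
  generalize stdCdf (l * x) = C at *
  field_simp
  ring

lemma sn_mills (l : ℝ) (hl : l < 0) :
    (∀ᶠ t in atTop, 0 < 1 - snCdf l t) ∧
    Tendsto (fun t => t * (snPdf l t / (1 - snCdf l t) - (1 + l ^ 2) * t)) atTop (𝓝 (1 + 1)) ∧
    Tendsto (fun t => t ^ 2 * (1 - snCdf l t)) atTop (𝓝 0) := by
  have hc : 0 < 1 + l ^ 2 := by positivity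
  have hG : ∀ t, HasDerivAt (fun t => 1 - snCdf l t) (-(snPdf l t)) t := fun t =>
    (cdf_hasDerivAt _ (snPdf_cont l) (snPdf_int l) t).const_sub 1
  have hf0 : Tendsto (snPdf l) atTop (𝓝 0) := by simpa using pow_mul_snPdf l 0
  have hG0 : Tendsto (fun t => 1 - snCdf l t) atTop (𝓝 0) := by
    have := (cdf_tendsto _ (snPdf_int l)).const_sub 1
    rw [snPdf_total, sub_self] at this
    exact this
  have hq : Tendsto (fun t => t * ((t - l * (stdPhi (l * t) / stdCdf (l * t))) - (1 + l ^ 2) * t))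
      atTop (𝓝 1) := by
    have ht : Tendsto (fun t => -l * t) atTop atTop :=
      tendsto_id.const_mul_atTop (by linarith)
    have := stdCdf_mills.comp ht
    rw [zero_add] at this
    refine this.congr fun t => ?_
    have e : -l * t = -(l * t) := by ring
    simp only [Function.comp, e, stdPhi_neg, neg_neg]
    ring
  obtain ⟨h1, h2⟩ := mills_two _ _ _ _ _ hc (snPdf_pos l) (snPdf_hasDerivAt l) hG hf0 hG0 hq
  refine ⟨h1, h2, ?_⟩
  have h3 := (mills_one _ _ _ _ _ hc (snPdf_pos l) (snPdf_hasDerivAt l) hG hf0 hG0 hq).mul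
    (pow_mul_snPdf l 1)
  rw [mul_zero] at h3
  refine h3.congr' ?_
  filter_upwards [eventually_gt_atTop 0] with t ht
  have := (snPdf_pos l t).ne'
  field_simp

lemma log_increment (f G : ℝ → ℝ) (c : ℝ) (hc : 0 < c)
    (hG : ∀ t, HasDerivAt G (-(f t)) t)
    (hpos : ∀ᶠ t in atTop, 0 < G t)
    (hm : Tendsto (fun t => t * (f t / G t - c * t)) atTop (𝓝 (1 + 1))) (x : ℝ) :
    Tendsto (fun t => t ^ 2 * ((Real.log (G (t + x / (c * t))) + c * (t + x / (c * t)) ^ 2 / 2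
      + 2 * Real.log (t + x / (c * t)))
      - (Real.log (G t) + c * t ^ 2 / 2 + 2 * Real.log t))) atTop (𝓝 0) := by
  rw [Metric.tendsto_atTop']
  intro δ hδ
  obtain ⟨ε, hε, hεδ⟩ : ∃ ε : ℝ, 0 < ε ∧ 2 * ε * (|x| / c) < δ := by
    have hA : 0 ≤ |x| / c := by positivity
    refine ⟨δ / (2 * (|x| / c + 1)), by positivity, ?_⟩
    have e : 2 * (δ / (2 * (|x| / c + 1))) * (|x| / c) = δ * ((|x| / c) / (|x| / c + 1)) := by
      field_simp
    rw [e]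
    have : (|x| / c) / (|x| / c + 1) < 1 := by
      rw [div_lt_one (by positivity)]; linarith
    nlinarith
  have hev : ∀ᶠ s in atTop, |s * (f s / G s - c * s) - (1 + 1)| < ε ∧ 0 < G s ∧ 0 < s := by
    refine ((Metric.tendsto_nhds.1 hm) ε hε).and (hpos.and (eventually_gt_atTop 0))
  obtain ⟨T, hT⟩ := eventually_atTop.1 hev
  have hT0 : 0 < T := (hT T le_rfl).2.2
  refine ⟨max (2 * T) (max 1 (2 * |x| / c)), fun t ht => ?_⟩
  have ht1 : 2 * T < t := lt_of_le_of_lt (le_max_left _ _) ht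
  have ht2 : 1 < t := lt_of_le_of_lt ((le_max_left _ _).trans (le_max_right _ _)) ht
  have ht3 : 2 * |x| / c < t := lt_of_le_of_lt ((le_max_right _ _).trans (le_max_right _ _)) ht
  have ht0 : 0 < t := by linarith
  have hy : t / 2 ≤ t + x / (c * t) := by
    have h1 : |x| / (c * t) ≤ t / 2 := by
      rw [div_lt_iff₀ hc] at ht3
      rw [div_le_div_iff₀ (by positivity) two_pos]
      nlinarith [mul_pos hc ht0]
    have h2 : -(|x| / (c * t)) ≤ x / (c * t) := by
      rw [← neg_div]; gcongr; exact neg_abs_le x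
    linarith
  have key := Convex.norm_image_sub_le_of_norm_hasDerivWithin_le
    (f := fun s => Real.log (G s) + c * s ^ 2 / 2 + 2 * Real.log s)
    (f' := fun s => -(f s) / G s + c * s + 2 / s) (s := Set.Ici (t / 2)) (x := t)
    (y := t + x / (c * t)) (C := 2 * ε / t) ?_ ?_ (convex_Ici _) (by simp; linarith) hy
  · simp only [Real.norm_eq_abs, add_sub_cancel_left] at key
    rw [Real.dist_eq, sub_zero, abs_mul, abs_of_nonneg (by positivity : 0 ≤ t ^ 2)]
    refine lt_of_le_of_lt (mul_le_mul_of_nonneg_left key (by positivity)) ?_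
    rw [abs_div, abs_of_pos (mul_pos hc ht0)]
    refine lt_of_eq_of_lt ?_ hεδ
    field_simp
  · intro s hs
    have hs' : t / 2 ≤ s := hs
    obtain ⟨-, h2, h3⟩ := hT s (by linarith)
    refine HasDerivAt.hasDerivWithinAt ?_
    have d1 := (hG s).log h2.ne'
    have d2 := ((hasDerivAt_pow 2 s).const_mul c).div_const 2
    have d3 := (Real.hasDerivAt_log h3.ne').const_mul 2
    refine HasDerivAt.congr_deriv ((d1.add d2).add d3) ?_
    simp; ring
  · intro s hs
    have hs' : t / 2 ≤ s := hs
    obtain ⟨h1, h2, h3⟩ := hT s (by linarith)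
    have e : -(f s) / G s + c * s + 2 / s = -(s * (f s / G s - c * s) - (1 + 1)) / s := by
      field_simp; ring
    rw [e, Real.norm_eq_abs, abs_div, abs_neg, abs_of_pos h3,
      div_le_div_iff₀ h3 ht0]
    nlinarith

lemma final_limit (f G : ℝ → ℝ) (c : ℝ) (hc : 0 < c)
    (hG : ∀ t, HasDerivAt G (-(f t)) t)
    (hpos : ∀ᶠ t in atTop, 0 < G t)
    (hm : Tendsto (fun t => t * (f t / G t - c * t)) atTop (𝓝 (1 + 1)))
    (hG2 : Tendsto (fun t => t ^ 2 * G t) atTop (𝓝 0)) (x : ℝ) :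
    Tendsto (fun t => t ^ 2 * (Real.log (1 - G (t + x / (c * t))) / G t + Real.exp (-x))) atTop
      (𝓝 (2⁻¹ * c⁻¹ * (x ^ 2 + 4 * x) * Real.exp (-x))) := by
  have h1 := log_increment f G c hc hG hpos hm x
  have hinv : Tendsto (fun t : ℝ => t⁻¹) atTop (𝓝 0) := tendsto_inv_atTop_zero
  have hsq : Tendsto (fun t : ℝ => t ^ 2) atTop atTop := tendsto_pow_atTop two_ne_zero
  have hlog : Tendsto (fun t : ℝ => t ^ 2 * Real.log (1 + (x / c) / t ^ 2)) atTop (𝓝 (x / c)) :=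
    (Real.tendsto_mul_log_one_add_div_atTop (x / c)).comp hsq
  have hy : Tendsto (fun t : ℝ => t + x / (c * t)) atTop atTop := by
    have : Tendsto (fun t : ℝ => x / (c * t)) atTop (𝓝 0) := by
      have := hinv.const_mul (x / c)
      rw [mul_zero] at this
      refine this.congr fun t => ?_
      rw [← div_div, div_eq_mul_inv (x / c)]
    exact tendsto_id.atTop_add this
  have hypos := hy.eventually (eventually_gt_atTop 0)
  have hGy := hy.eventually hpos
  have h2 : Tendsto (fun t => t ^ 2 * (Real.log (G (t + x / (c * t)) / G t) + x)) atTop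
      (𝓝 (-(x ^ 2 / (2 * c) + 2 * (x / c)))) := by
    have := (h1.sub_const (x ^ 2 / (2 * c))).sub (hlog.const_mul 2)
    have e : (0 : ℝ) - x ^ 2 / (2 * c) - 2 * (x / c) = -(x ^ 2 / (2 * c) + 2 * (x / c)) := by ring
    rw [e] at this
    refine this.congr' ?_
    filter_upwards [eventually_gt_atTop 0, hypos, hpos, hGy] with t ht a1 a2 a3
    have e1 : t + x / (c * t) = t * (1 + (x / c) / t ^ 2) := by field_simp
    have hz : 0 < 1 + (x / c) / t ^ 2 := by
      rw [e1] at a1; exact (mul_pos_iff_of_pos_left ht).1 a1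
    have e2 : Real.log (t + x / (c * t)) = Real.log t + Real.log (1 + (x / c) / t ^ 2) := by
      rw [e1, Real.log_mul ht.ne' hz.ne']
    rw [e2, Real.log_div a3.ne' a2.ne']
    field_simp
    ring
  have hu : Tendsto (fun t => Real.log (G (t + x / (c * t)) / G t)) atTop (𝓝 (-x)) := by
    have := ((h2.mul (hinv.mul hinv)).sub_const x)
    rw [mul_zero, mul_zero, zero_sub] at this
    refine this.congr' ?_
    filter_upwards [eventually_gt_atTop 0] with t ht
    field_simp
    ring
  have hR : Tendsto (fun t => G (t + x / (c * t)) / G t) atTop (𝓝 (Real.exp (-x))) := by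
    refine ((Real.continuous_exp.tendsto _).comp hu).congr' ?_
    filter_upwards [hpos, hGy] with t a2 a3
    exact Real.exp_log (div_pos a3 a2)
  have h3 : Tendsto (fun t => t ^ 2 * (G (t + x / (c * t)) / G t - Real.exp (-x))) atTop
      (𝓝 (-(x ^ 2 / (2 * c) + 2 * (x / c)) * Real.exp (-x))) := by
    have hd : Tendsto (dslope Real.exp (-x)) (𝓝 (-x)) (𝓝 (Real.exp (-x))) := by
      have := (continuousAt_dslope_same (f := Real.exp) (a := -x)).2 Real.differentiableAt_exp
      have h := this.tendsto
      rwa [dslope_same, Real.deriv_exp] at h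
    refine (h2.mul (hd.comp hu)).congr' ?_
    filter_upwards [hpos, hGy] with t a2 a3
    have := sub_smul_dslope Real.exp (-x) (Real.log (G (t + x / (c * t)) / G t))
    rw [Real.exp_log (div_pos a3 a2), smul_eq_mul, sub_neg_eq_add] at this
    simp only [Function.comp]
    rw [mul_assoc, this]
  have hGy2 : Tendsto (fun t => t ^ 2 * G (t + x / (c * t))) atTop (𝓝 0) := by
    have := hR.mul hG2
    rw [mul_zero] at this
    refine this.congr' ?_
    filter_upwards [hpos] with t a2
    field_simp
  have hGy0 : Tendsto (fun t => G (t + x / (c * t))) atTop (𝓝 0) := by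
    have := hGy2.mul (hinv.mul hinv)
    rw [zero_mul] at this
    refine this.congr' ?_
    filter_upwards [eventually_gt_atTop 0] with t ht
    field_simp
  have h4 : Tendsto (fun t => t ^ 2 * (Real.log (1 - G (t + x / (c * t))) / G t
      + G (t + x / (c * t)) / G t)) atTop (𝓝 0) := by
    have hb := (hR.mul hGy2).const_mul 2
    rw [mul_zero, mul_zero] at hb
    refine squeeze_zero_norm' ?_ hb
    filter_upwards [hpos, hGy, hGy0.eventually (gt_mem_nhds (by norm_num : (0:ℝ) < 1 / 2))]
      with t a2 a3 a4
    generalize G (t + x / (c * t)) = g at *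
    have hl := Real.abs_log_sub_add_sum_range_le (x := g) (by rw [abs_of_pos a3]; linarith) 1
    simp only [Finset.sum_range_one, abs_of_pos a3] at hl
    norm_num at hl
    have hl2 : g ^ 2 / (1 - g) ≤ 2 * g ^ 2 := by
      rw [div_le_iff₀ (by linarith)]
      nlinarith [sq_nonneg g]
    rw [← add_div, Real.norm_eq_abs, abs_mul, abs_div, abs_of_pos a2,
      abs_of_nonneg (sq_nonneg t), add_comm]
    calc t ^ 2 * (|g + Real.log (1 - g)| / G t) ≤ t ^ 2 * (2 * g ^ 2 / G t) := by
          gcongr; exact hl.trans hl2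
      _ = 2 * (g / G t * (t ^ 2 * g)) := by ring
  have h5 := h4.sub h3
  have e : (0 : ℝ) - -(x ^ 2 / (2 * c) + 2 * (x / c)) * Real.exp (-x) =
      2⁻¹ * c⁻¹ * (x ^ 2 + 4 * x) * Real.exp (-x) := by field_simp; ring
  rw [e] at h5
  refine h5.congr fun t => ?_
  ring

lemma snCdf_mono (l : ℝ) : Monotone (snCdf l) := by
  refine monotone_of_hasDerivAt_nonneg
    (fun t => cdf_hasDerivAt _ (snPdf_cont l) (snPdf_int l) t) fun t => (snPdf_pos l t).le

theorem skew_normal_h_limit_neg (l : ℝ) (hl : l < 0) (b : ℕ → ℝ)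
    (hb : ∀ n : ℕ, 2 ≤ n → snCdf l (b n) = 1 - 1 / n) (x : ℝ) :
    Tendsto (fun n : ℕ =>
      (b n) ^ 2 * ((n : ℝ) * Real.log (snCdf l (b n + x / ((1 + l ^ 2) * b n))) +
        Real.exp (-x))) atTop (𝓝 (kappaNeg l x)) := by
  have hc : 0 < 1 + l ^ 2 := by positivity
  obtain ⟨h1, h2, h3⟩ := sn_mills l hl
  have hG : ∀ t, HasDerivAt (fun t => 1 - snCdf l t) (-(snPdf l t)) t := fun t =>
    (cdf_hasDerivAt _ (snPdf_cont l) (snPdf_int l) t).const_sub 1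
  have hlim := final_limit (snPdf l) (fun t => 1 - snCdf l t) (1 + l ^ 2) hc hG h1 h2 h3 x
  have hbt : Tendsto b atTop atTop := by
    rw [tendsto_atTop]
    intro M
    obtain ⟨M', hM1, hM2⟩ := (h1.and (eventually_ge_atTop M)).exists
    have hn : Tendsto (fun n : ℕ => 1 - 1 / (n : ℝ)) atTop (𝓝 1) := by
      have := (tendsto_one_div_atTop_nhds_zero_nat (𝕜 := ℝ)).const_sub 1
      rwa [sub_zero] at this
    filter_upwards [eventually_ge_atTop 2,
      hn.eventually (lt_mem_nhds (by linarith : snCdf l M' < 1))] with n hn2 hlt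
    rw [← hb n hn2] at hlt
    exact hM2.trans ((snCdf_mono l).reflect_lt hlt).le
  refine (hlim.comp hbt).congr' ?_
  filter_upwards [eventually_ge_atTop 2] with n hn
  have hn0 : (n : ℝ) ≠ 0 := by positivity
  simp only [Function.comp, sub_sub_cancel, hb n hn]
  rw [div_div_eq_mul_div, div_one]
  ring
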